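/- Fix λ > 0, μ ∈ ℝ, T > 0, and a measurable 1-periodic initial datum ρ₀ : ℝ → [0,1]. Call a measurable function ρ : ℝ × [0,T] → [0,1], 1-periodic in the space variable, a weak solution of the Cauchy problem for the viscous Burgers equation with initial datum ρ₀ if for every smooth function θ : ℝ × [0,T] → ℝ that is 1-periodic in x and satisfies θ(·,T) ≡ 0, one has ∫₀^T ∫₀¹ [ ρ (∂θ/∂t + λ ∂²θ/∂x²) − μ ρ(1−ρ) ∂θ/∂x ] dx dt + ∫₀¹ ρ₀(x) θ(x,0) dx = 0. Then the weak solution is unique: any two weak solutions with the same initial datum ρ₀ coincide almost everywhere on [0,1] × [0,T]. -/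

import Mathlib

open MeasureTheory

/-- A measurable function `ρ : ℝ × [0,T] → [0,1]`, 1-periodic in the space
variable, is a weak solution of the Cauchy problem for the viscous Burgers
equation `∂ρ/∂t = λ ∂²ρ/∂x² + μ(1-2ρ)∂ρ/∂x` with initial datum `ρ₀` if for
every smooth test function `θ`, 1-periodic in `x`, vanishing at time `T`,
`∫₀ᵀ∫₀¹ [ρ (∂θ/∂t + λ ∂²θ/∂x²) - μ ρ(1-ρ) ∂θ/∂x] dx dt + ∫₀¹ ρ₀(x) θ(x,0) dx = 0`. -/
def IsWeakSolutionBurgers (lam mu T : ℝ) (ρ₀ : ℝ → ℝ) (ρ : ℝ → ℝ → ℝ) : Prop :=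
  Measurable (fun p : ℝ × ℝ => ρ p.1 p.2)
  ∧ (∀ x t, ρ (x + 1) t = ρ x t)
  ∧ (∀ x t, t ∈ Set.Icc 0 T → ρ x t ∈ Set.Icc (0 : ℝ) 1)
  ∧ ∀ θ : ℝ → ℝ → ℝ, ContDiff ℝ (⊤ : ℕ∞) (fun p : ℝ × ℝ => θ p.1 p.2) →
      (∀ x t, θ (x + 1) t = θ x t) → (∀ x, θ x T = 0) →
      (∫ t in Set.Icc 0 T, ∫ x in Set.Icc (0 : ℝ) 1,
          (ρ x t * (deriv (θ x) t + lam * iteratedDeriv 2 (fun y => θ y t) x)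
            - mu * ρ x t * (1 - ρ x t) * deriv (fun y => θ y t) x))
        + ∫ x in Set.Icc (0 : ℝ) 1, ρ₀ x * θ x 0 = 0

lemma bm_locInt {f : ℝ → ℝ} (hf : Measurable f) {C : ℝ} (hC : ∀ x, |f x| ≤ C) :
    LocallyIntegrable f volume := by
  have : LocallyIntegrable (fun _ : ℝ => C) volume := locallyIntegrable_const C
  refine this.mono hf.aestronglyMeasurable (Filter.Eventually.of_forall fun x => ?_)
  rw [Real.norm_eq_abs, Real.norm_eq_abs]
  exact (hC x).trans (le_abs_self C)

lemma locInt_ii {f : ℝ → ℝ} (hf : LocallyIntegrable f volume) (a b : ℝ) :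
    IntervalIntegrable f volume a b :=
  (hf.integrableOn_isCompact isCompact_uIcc).intervalIntegrable

lemma weak_ode {T : ℝ} (hT : 0 < T) {f h : ℝ → ℝ}
    (hf : LocallyIntegrable f volume) (hh : LocallyIntegrable h volume)
    (hw : ∀ φ : ℝ → ℝ, ContDiff ℝ (⊤ : ℕ∞) φ → φ T = 0 →
      ∫ t in (0:ℝ)..T, (deriv φ t * f t + φ t * h t) = 0) :
    ∀ᵐ t ∂(volume.restrict (Set.Icc 0 T)), f t = ∫ s in (0:ℝ)..t, h s := by
  have hfi : ∀ a b, IntervalIntegrable f volume a b := fun a b => locInt_ii hf a b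
  have hhi : ∀ a b, IntervalIntegrable h volume a b := fun a b => locInt_ii hh a b
  have hGc : Continuous (fun t => ∫ s in (0:ℝ)..t, h s) :=
    intervalIntegral.continuous_primitive hhi 0
  have hae := LocallyIntegrable.ae_hasDerivAt_integral hh
  have key : ∀ᵐ t ∂(volume.restrict (Set.Icc 0 T)), f t - ∫ s in (0:ℝ)..t, h s = 0 := by
    apply ae_eq_zero_of_integral_contDiff_smul_eq_zero
    · have h1 : IntegrableOn f (Set.Icc 0 T) := hf.integrableOn_isCompact isCompact_Icc
      have h2 : IntegrableOn (fun t => ∫ s in (0:ℝ)..t, h s) (Set.Icc 0 T) :=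
        hGc.locallyIntegrable.integrableOn_isCompact isCompact_Icc
      exact (Integrable.sub h1 h2).locallyIntegrable
    · intro ψ hψ _
      have hψd : ∀ t, HasDerivAt (fun t => ∫ s in T..t, ψ s) (ψ t) t := fun t =>
        intervalIntegral.integral_hasDerivAt_right (hψ.continuous.intervalIntegrable _ _)
          (hψ.continuous.stronglyMeasurableAtFilter _ _) hψ.continuous.continuousAt
      have hψd' : deriv (fun t => ∫ s in T..t, ψ s) = ψ := funext fun t => (hψd t).deriv
      have hφ : ContDiff ℝ (⊤ : ℕ∞) (fun t => ∫ s in T..t, ψ s) := by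
        rw [contDiff_infty_iff_deriv, hψd']
        exact ⟨fun t => (hψd t).differentiableAt, hψ⟩
      have e1 := hw _ hφ (by simp)
      rw [hψd'] at e1
      have ac1 : AbsolutelyContinuousOnInterval (fun t => ∫ s in T..t, ψ s) 0 T :=
        (hψ.continuous.intervalIntegrable 0 T).absolutelyContinuousOnInterval_intervalIntegral
          (by simp)
      have ac2 : AbsolutelyContinuousOnInterval (fun t => ∫ s in (0:ℝ)..t, h s) 0 T :=
        (hhi 0 T).absolutelyContinuousOnInterval_intervalIntegral (by simp)
      have e2 := ac1.integral_deriv_mul_eq_sub ac2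
      rw [hψd'] at e2
      have e3 : ∫ x in (0:ℝ)..T, (ψ x * (∫ s in (0:ℝ)..x, h s) + (∫ s in T..x, ψ s) * h x) = 0 := by
        simp only [intervalIntegral.integral_same, zero_mul, mul_zero, sub_zero] at e2
        refine Eq.trans ?_ e2
        apply intervalIntegral.integral_congr_ae
        filter_upwards [hae] with x hx _
        rw [(hx 0).deriv]
      have hφc : Continuous (fun t => ∫ s in T..t, ψ s) := hφ.continuous
      have i1 : IntervalIntegrable (fun t => ψ t * f t + (∫ s in T..t, ψ s) * h t) volume 0 T :=
        ((hfi 0 T).continuousOn_mul hψ.continuous.continuousOn).add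
          ((hhi 0 T).continuousOn_mul hφc.continuousOn)
      have i2 : IntervalIntegrable (fun x => ψ x * (∫ s in (0:ℝ)..x, h s)
          + (∫ s in T..x, ψ s) * h x) volume 0 T :=
        ((hψ.continuous.mul hGc).intervalIntegrable _ _).add
          ((hhi 0 T).continuousOn_mul hφc.continuousOn)
      rw [integral_Icc_eq_integral_Ioc, ← intervalIntegral.integral_of_le hT.le]
      have e4 := intervalIntegral.integral_sub i1 i2
      rw [e1, e3, sub_zero] at e4
      refine Eq.trans ?_ e4
      congr 1
      ext x
      simp only [smul_eq_mul]
      ring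
  filter_upwards [key] with t ht
  linarith

lemma energy {lam κ T : ℝ} (hlam : 0 < lam) {f g : ℝ → ℝ}
    (hf : LocallyIntegrable f volume) (hg : Measurable g) {C : ℝ} (hC : ∀ t, |g t| ≤ C)
    (h : ∀ᵐ t ∂(volume.restrict (Set.Icc 0 T)),
      f t = ∫ s in (0:ℝ)..t, (-(lam * κ ^ 2) * f s + κ * g s)) :
    ∀ᵐ t ∂(volume.restrict (Set.Icc 0 T)),
      f t ^ 2 ≤ (1 / (2 * lam)) * ∫ s in (0:ℝ)..t, g s ^ 2 := by
  have hgl := bm_locInt hg hC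
  have hg2 : LocallyIntegrable (fun t => g t ^ 2) volume := by
    refine bm_locInt (C := C ^ 2) (hg.pow_const 2) fun x => ?_
    rw [abs_pow]
    exact pow_le_pow_left₀ (abs_nonneg _) (hC x) 2
  have hhl : LocallyIntegrable (fun s => -(lam * κ ^ 2) * f s + κ * g s) volume :=
    (hf.smul (-(lam * κ ^ 2))).add (hgl.smul κ)
  have hGc : Continuous (fun t => ∫ s in (0:ℝ)..t, (-(lam * κ ^ 2) * f s + κ * g s)) :=
    intervalIntegral.continuous_primitive (fun a b => locInt_ii hhl a b) 0
  have hae := LocallyIntegrable.ae_hasDerivAt_integral hhl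
  have h' := h
  rw [ae_restrict_iff' measurableSet_Icc] at h'
  filter_upwards [h, ae_restrict_mem measurableSet_Icc] with t ht htm
  have ac := (locInt_ii hhl 0 t).absolutelyContinuousOnInterval_intervalIntegral (c := 0) (by simp)
  have e := ac.integral_deriv_mul_eq_sub ac
  simp only [intervalIntegral.integral_same, mul_zero, sub_zero] at e
  rw [ht, sq, ← e, ← intervalIntegral.integral_const_mul]
  apply intervalIntegral.integral_mono_ae_restrict htm.1
  · exact (ac.intervalIntegrable_deriv.mul_continuousOn hGc.continuousOn).add
      (ac.intervalIntegrable_deriv.continuousOn_mul hGc.continuousOn)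
  · exact (locInt_ii hg2 0 t).const_mul _
  · rw [Filter.EventuallyLE, ae_restrict_iff' measurableSet_Icc]
    filter_upwards [hae, h'] with s hs1 hs2 hs3
    rw [(hs1 0).deriv, ← hs2 ⟨hs3.1, hs3.2.trans htm.2⟩]
    rw [div_mul_eq_mul_div, le_div_iff₀ (by positivity)]
    nlinarith [sq_nonneg (2 * lam * κ * f s - g s)]

lemma parseval {u : ℝ → ℝ} (hu : Measurable u) {C : ℝ} (hC : ∀ x, |u x| ≤ C) :
    HasSum (fun k : ℤ => (∫ x in Set.Icc (0:ℝ) 1, u x * Real.cos (2 * Real.pi * k * x)) ^ 2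
      + (∫ x in Set.Icc (0:ℝ) 1, u x * Real.sin (2 * Real.pi * k * x)) ^ 2)
      (∫ x in Set.Icc (0:ℝ) 1, u x ^ 2) := by
  have hL2 : MemLp (fun x => (u x : ℂ)) 2 (volume.restrict (Set.Ioc (0:ℝ) 1)) := by
    refine MemLp.of_bound (Complex.measurable_ofReal.comp hu).aestronglyMeasurable C
      (Filter.Eventually.of_forall fun x => ?_)
    simpa using hC x
  have hS := hasSum_sq_fourierCoeffOn zero_lt_one hL2
  have hui : ∀ v : ℝ → ℝ, Continuous v → IntegrableOn (fun x => u x * v x) (Set.Icc 0 1) := by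
    intro v hv
    exact ((bm_locInt hu hC).integrableOn_isCompact isCompact_Icc).mul_continuousOn
      hv.continuousOn isCompact_Icc
  convert hS using 1
  · ext k
    rw [fourierCoeffOn_eq_integral, intervalIntegral.integral_of_le zero_le_one,
      ← integral_Icc_eq_integral_Ioc]
    have : ∫ x in Set.Icc (0:ℝ) 1, (fourier (-k) (x : AddCircle ((1:ℝ) - 0)) • (u x : ℂ))
       = ((∫ x in Set.Icc (0:ℝ) 1, u x * Real.cos (2 * Real.pi * k * x) : ℝ) : ℂ)
        - ((∫ x in Set.Icc (0:ℝ) 1, u x * Real.sin (2 * Real.pi * k * x) : ℝ) : ℂ) * Complex.I := by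
      rw [← integral_complex_ofReal, ← integral_complex_ofReal, ← integral_mul_const, ← integral_sub]
      · congr 1
        ext x
        rw [fourier_coe_apply]
        have : (2 * Real.pi * Complex.I * ((-k : ℤ) : ℂ) * x / ((1 - 0 : ℝ) : ℂ) : ℂ)
          = ((-(2 * Real.pi * k * x) : ℝ) : ℂ) * Complex.I := by
          push_cast; ring
        rw [this, Complex.exp_mul_I, ← Complex.ofReal_cos, ← Complex.ofReal_sin, Real.cos_neg, Real.sin_neg]
        push_cast
        simp only [smul_eq_mul]
        ring
      · exact (hui _ (by fun_prop)).ofReal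
      · exact (hui _ (by fun_prop)).ofReal.mul_const _
    rw [this]
    rw [← Complex.normSq_eq_norm_sq]
    simp [Complex.normSq_apply]
    ring
  · rw [intervalIntegral.integral_of_le zero_le_one, ← integral_Icc_eq_integral_Ioc]
    simp

lemma gronwall {T K M : ℝ} (hK : 0 ≤ K) {E : ℝ → ℝ} (hE : LocallyIntegrable E volume)
    (hb : ∀ t, E t ≤ M)
    (h : ∀ᵐ t ∂(volume.restrict (Set.Icc 0 T)), E t ≤ K * ∫ s in (0:ℝ)..t, E s) :
    ∀ᵐ t ∂(volume.restrict (Set.Icc 0 T)), E t ≤ 0 := by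
  have ind : ∀ n : ℕ, ∀ᵐ t ∂(volume.restrict (Set.Icc 0 T)),
      E t ≤ M * ((K * t) ^ n / n.factorial) := by
    intro n
    induction n with
    | zero => exact Filter.Eventually.of_forall fun t => by simpa using hb t
    | succ n ih =>
      rw [ae_restrict_iff' measurableSet_Icc] at ih
      filter_upwards [h, ae_restrict_mem measurableSet_Icc] with t ht htm
      refine ht.trans ?_
      have : ∫ s in (0:ℝ)..t, E s ≤ ∫ s in (0:ℝ)..t, M * ((K * s) ^ n / n.factorial) := by
        apply intervalIntegral.integral_mono_ae_restrict htm.1 (locInt_ii hE 0 t)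
        · exact Continuous.intervalIntegrable (by fun_prop) _ _
        · rw [Filter.EventuallyLE, ae_restrict_iff' measurableSet_Icc]
          filter_upwards [ih] with s hs hsm
          exact hs ⟨hsm.1, hsm.2.trans htm.2⟩
      refine (mul_le_mul_of_nonneg_left this hK).trans (le_of_eq ?_)
      simp only [mul_pow, intervalIntegral.integral_const_mul, intervalIntegral.integral_div, integral_pow]
      rw [Nat.factorial_succ]
      push_cast
      field_simp
      ring
  rw [← ae_all_iff] at ind
  filter_upwards [ind] with t ht
  have : Filter.Tendsto (fun n : ℕ => M * ((K * t) ^ n / n.factorial)) Filter.atTop (nhds (M * 0)) :=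
    (FloorSemiring.tendsto_pow_div_factorial_atTop (K * t)).const_mul M
  rw [mul_zero] at this
  exact ge_of_tendsto' this ht

lemma slice_meas {v : ℝ → ℝ → ℝ} (hv : Measurable (fun p : ℝ × ℝ => v p.1 p.2)) :
    Measurable (fun t => ∫ x in Set.Icc (0:ℝ) 1, v x t) :=
  (hv.stronglyMeasurable.integral_prod_left (μ := volume.restrict (Set.Icc (0:ℝ) 1))).measurable

lemma slice_meas_x {v : ℝ → ℝ → ℝ} (hv : Measurable (fun p : ℝ × ℝ => v p.1 p.2)) (t : ℝ) :
    Measurable (fun x => v x t) :=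
  hv.comp (measurable_id.prodMk measurable_const)

lemma slice_bdd {v : ℝ → ℝ → ℝ} {C : ℝ} (hC : ∀ x t, |v x t| ≤ C) (t : ℝ) :
    |∫ x in Set.Icc (0:ℝ) 1, v x t| ≤ C := by
  have := norm_setIntegral_le_of_norm_le_const (μ := volume) (s := Set.Icc (0:ℝ) 1)
    (f := fun x => v x t) (C := C) (by simp) (fun x _ => hC x t)
  simpa using this

lemma slice_int {v : ℝ → ℝ → ℝ} {C : ℝ} (hv : Measurable (fun p : ℝ × ℝ => v p.1 p.2))
    (hC : ∀ x t, |v x t| ≤ C) (t : ℝ) :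
    IntegrableOn (fun x => v x t) (Set.Icc (0:ℝ) 1) :=
  (bm_locInt (slice_meas_x hv t) (fun x => hC x t)).integrableOn_isCompact isCompact_Icc

/-- truncation of a solution in time -/
noncomputable def trunc (T : ℝ) (ρ : ℝ → ℝ → ℝ) (x t : ℝ) : ℝ :=
  (Set.Icc (0:ℝ) T).indicator (fun t => ρ x t) t

lemma trunc_meas {lam mu T : ℝ} {ρ₀ : ℝ → ℝ} {ρ : ℝ → ℝ → ℝ}
    (h : IsWeakSolutionBurgers lam mu T ρ₀ ρ) :
    Measurable (fun p : ℝ × ℝ => trunc T ρ p.1 p.2) := by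
  have : (fun p : ℝ × ℝ => trunc T ρ p.1 p.2)
      = (Prod.snd ⁻¹' (Set.Icc (0:ℝ) T)).indicator (fun p : ℝ × ℝ => ρ p.1 p.2) := by
    ext p
    simp [trunc, Set.indicator]
  rw [this]
  exact h.1.indicator (measurable_snd measurableSet_Icc)

lemma trunc_mem {lam mu T : ℝ} {ρ₀ : ℝ → ℝ} {ρ : ℝ → ℝ → ℝ}
    (h : IsWeakSolutionBurgers lam mu T ρ₀ ρ) (x t : ℝ) :
    0 ≤ trunc T ρ x t ∧ trunc T ρ x t ≤ 1 := by
  by_cases ht : t ∈ Set.Icc 0 T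
  · rw [trunc, Set.indicator_of_mem ht]
    exact h.2.2.1 x t ht
  · rw [trunc, Set.indicator_of_notMem ht]
    simp

lemma weak_mode {lam mu T κ : ℝ} (hT : 0 < T) {ρ₀ : ℝ → ℝ} {ρ : ℝ → ℝ → ℝ}
    (h : IsWeakSolutionBurgers lam mu T ρ₀ ρ) {e d : ℝ → ℝ}
    (he : ContDiff ℝ (⊤ : ℕ∞) e) (hper : ∀ x, e (x + 1) = e x)
    (hed : ∀ x, HasDerivAt e (κ * d x) x) (hde : ∀ x, HasDerivAt d (-κ * e x) x)
    (he1 : ∀ x, |e x| ≤ 1) (hd1 : ∀ x, |d x| ≤ 1)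
    {φ : ℝ → ℝ} (hφ : ContDiff ℝ (⊤ : ℕ∞) φ) (hφT : φ T = 0) :
    (∫ t in (0:ℝ)..T, (deriv φ t * (∫ x in Set.Icc (0:ℝ) 1, trunc T ρ x t * e x)
      + φ t * (-(lam * κ ^ 2) * (∫ x in Set.Icc (0:ℝ) 1, trunc T ρ x t * e x)
        + κ * (∫ x in Set.Icc (0:ℝ) 1, (-mu * (trunc T ρ x t * (1 - trunc T ρ x t))) * d x))))
      + ∫ x in Set.Icc (0 : ℝ) 1, ρ₀ x * (e x * φ 0) = 0 := by
  have hm := trunc_meas h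
  have hb := trunc_mem h
  have hec : Measurable e := he.continuous.measurable
  have hdc : Measurable d :=
    (continuous_iff_continuousAt.2 fun x => (hde x).continuousAt).measurable
  have hAm : Measurable (fun p : ℝ × ℝ => trunc T ρ p.1 p.2 * e p.1) :=
    hm.mul (hec.comp measurable_fst)
  have hAb : ∀ x t, |trunc T ρ x t * e x| ≤ 1 := fun x t => by
    rw [abs_mul, abs_of_nonneg (hb x t).1]
    exact mul_le_one₀ (hb x t).2 (abs_nonneg _) (he1 x)
  have hBm : Measurable (fun p : ℝ × ℝ =>
      (-mu * (trunc T ρ p.1 p.2 * (1 - trunc T ρ p.1 p.2))) * d p.1) :=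
    ((hm.mul (hm.const_sub 1)).const_mul (-mu)).mul (hdc.comp measurable_fst)
  have hBb : ∀ x t, |(-mu * (trunc T ρ x t * (1 - trunc T ρ x t))) * d x| ≤ |mu| := fun x t => by
    obtain ⟨h0, h1⟩ := hb x t
    rw [abs_mul, abs_mul, abs_neg, abs_of_nonneg (mul_nonneg h0 (by linarith)), mul_assoc]
    have h3 : trunc T ρ x t * (1 - trunc T ρ x t) ≤ 1 := by nlinarith
    exact mul_le_of_le_one_right (abs_nonneg _) (mul_le_one₀ h3 (abs_nonneg _) (hd1 x))
  have hw := h.2.2.2 (fun x t => e x * φ t)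
    ((he.comp contDiff_fst).mul (hφ.comp contDiff_snd))
    (fun x t => by simp only [hper]) (fun x => by simp [hφT])
  rw [intervalIntegral.integral_of_le hT.le, ← integral_Icc_eq_integral_Ioc]
  refine Eq.trans ?_ hw
  congr 1
  refine setIntegral_congr_fun measurableSet_Icc fun t ht => ?_
  have d1 : ∀ x, deriv (fun t => e x * φ t) t = e x * deriv φ t := fun x =>
    deriv_const_mul _ ((hφ.differentiable (by simp)) t)
  have d2 : (deriv fun y => e y * φ t) = fun x => κ * d x * φ t := by
    ext x
    exact ((hed x).mul_const (φ t)).deriv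
  have d3 : ∀ x, iteratedDeriv 2 (fun y => e y * φ t) x = κ * (-κ * e x) * φ t := fun x => by
    rw [iteratedDeriv_succ, iteratedDeriv_one, d2]
    exact (((hde x).const_mul κ).mul_const (φ t)).deriv
  have iA := slice_int hAm hAb t
  have iB := slice_int hBm hBb t
  have e1 : ∀ x, ρ x t * (deriv (fun t => e x * φ t) t
        + lam * iteratedDeriv 2 (fun y => e y * φ t) x)
      - mu * ρ x t * (1 - ρ x t) * deriv (fun y => e y * φ t) x
      = (deriv φ t - lam * κ ^ 2 * φ t) * (trunc T ρ x t * e x)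
        + (κ * φ t) * ((-mu * (trunc T ρ x t * (1 - trunc T ρ x t))) * d x) := fun x => by
    have : trunc T ρ x t = ρ x t := by rw [trunc, Set.indicator_of_mem ht]
    rw [d1, d3, d2, this]
    ring
  simp_rw [e1]
  rw [integral_add (iA.const_mul _) (iB.const_mul _), integral_const_mul, integral_const_mul]
  ring

lemma mode_est {lam mu T κ : ℝ} (hlam : 0 < lam) (hT : 0 < T) {ρ₀ : ℝ → ℝ} {ρ₁ ρ₂ : ℝ → ℝ → ℝ}
    (h1 : IsWeakSolutionBurgers lam mu T ρ₀ ρ₁) (h2 : IsWeakSolutionBurgers lam mu T ρ₀ ρ₂)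
    {w F : ℝ → ℝ → ℝ} (hw : w = fun x t => trunc T ρ₁ x t - trunc T ρ₂ x t)
    (hF : F = fun x t => -mu * (trunc T ρ₁ x t * (1 - trunc T ρ₁ x t))
      - (-mu * (trunc T ρ₂ x t * (1 - trunc T ρ₂ x t))))
    {e d : ℝ → ℝ}
    (he : ContDiff ℝ (⊤ : ℕ∞) e) (hper : ∀ x, e (x + 1) = e x)
    (hed : ∀ x, HasDerivAt e (κ * d x) x) (hde : ∀ x, HasDerivAt d (-κ * e x) x)
    (he1 : ∀ x, |e x| ≤ 1) (hd1 : ∀ x, |d x| ≤ 1) :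
    ∀ᵐ t ∂(volume.restrict (Set.Icc 0 T)),
      (∫ x in Set.Icc (0:ℝ) 1, w x t * e x) ^ 2
        ≤ (1 / (2 * lam)) * ∫ s in (0:ℝ)..t, (∫ x in Set.Icc (0:ℝ) 1, F x s * d x) ^ 2 := by
  have hec : Measurable e := he.continuous.measurable
  have hdc : Measurable d :=
    (continuous_iff_continuousAt.2 fun x => (hde x).continuousAt).measurable
  have A : ∀ ρ, IsWeakSolutionBurgers lam mu T ρ₀ ρ →
      Measurable (fun p : ℝ × ℝ => trunc T ρ p.1 p.2 * e p.1) ∧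
      (∀ x t, |trunc T ρ x t * e x| ≤ 1) := fun ρ h => by
    have hm := trunc_meas h
    have hb := trunc_mem h
    refine ⟨hm.mul (hec.comp measurable_fst), fun x t => ?_⟩
    rw [abs_mul, abs_of_nonneg (hb x t).1]
    exact mul_le_one₀ (hb x t).2 (abs_nonneg _) (he1 x)
  have B : ∀ ρ, IsWeakSolutionBurgers lam mu T ρ₀ ρ →
      Measurable (fun p : ℝ × ℝ =>
        (-mu * (trunc T ρ p.1 p.2 * (1 - trunc T ρ p.1 p.2))) * d p.1) ∧
      (∀ x t, |(-mu * (trunc T ρ x t * (1 - trunc T ρ x t))) * d x| ≤ |mu|) := fun ρ h => by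
    have hm := trunc_meas h
    have hb := trunc_mem h
    refine ⟨((hm.mul (hm.const_sub 1)).const_mul (-mu)).mul (hdc.comp measurable_fst),
      fun x t => ?_⟩
    obtain ⟨h0, h1⟩ := hb x t
    rw [abs_mul, abs_mul, abs_neg, abs_of_nonneg (mul_nonneg h0 (by linarith)), mul_assoc]
    have h3 : trunc T ρ x t * (1 - trunc T ρ x t) ≤ 1 := by nlinarith
    exact mul_le_of_le_one_right (abs_nonneg _) (mul_le_one₀ h3 (abs_nonneg _) (hd1 x))
  have ef : ∀ t, ∫ x in Set.Icc (0:ℝ) 1, w x t * e x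
      = (∫ x in Set.Icc (0:ℝ) 1, trunc T ρ₁ x t * e x)
        - ∫ x in Set.Icc (0:ℝ) 1, trunc T ρ₂ x t * e x := fun t => by
    rw [← integral_sub (slice_int (A _ h1).1 (A _ h1).2 t) (slice_int (A _ h2).1 (A _ h2).2 t), hw]
    simp only [sub_mul]
  have eg : ∀ t, ∫ x in Set.Icc (0:ℝ) 1, F x t * d x
      = (∫ x in Set.Icc (0:ℝ) 1, (-mu * (trunc T ρ₁ x t * (1 - trunc T ρ₁ x t))) * d x)
        - ∫ x in Set.Icc (0:ℝ) 1, (-mu * (trunc T ρ₂ x t * (1 - trunc T ρ₂ x t))) * d x :=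
    fun t => by
    rw [← integral_sub (slice_int (B _ h1).1 (B _ h1).2 t) (slice_int (B _ h2).1 (B _ h2).2 t), hF]
    simp only [sub_mul]
  have LA : ∀ ρ, IsWeakSolutionBurgers lam mu T ρ₀ ρ → LocallyIntegrable
      (fun t => ∫ x in Set.Icc (0:ℝ) 1, trunc T ρ x t * e x) volume := fun ρ h =>
    bm_locInt (slice_meas (v := fun x t => trunc T ρ x t * e x) (A ρ h).1)
      (slice_bdd (v := fun x t => trunc T ρ x t * e x) (A ρ h).2)
  have LB : ∀ ρ, IsWeakSolutionBurgers lam mu T ρ₀ ρ → LocallyIntegrable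
      (fun t => ∫ x in Set.Icc (0:ℝ) 1, (-mu * (trunc T ρ x t * (1 - trunc T ρ x t))) * d x)
      volume := fun ρ h =>
    bm_locInt
      (slice_meas (v := fun x t => (-mu * (trunc T ρ x t * (1 - trunc T ρ x t))) * d x) (B ρ h).1)
      (slice_bdd (v := fun x t => (-mu * (trunc T ρ x t * (1 - trunc T ρ x t))) * d x) (B ρ h).2)
  have Lf : LocallyIntegrable (fun t => ∫ x in Set.Icc (0:ℝ) 1, w x t * e x) volume := by
    simp_rw [ef]
    exact (LA _ h1).sub (LA _ h2)
  have Lg : LocallyIntegrable (fun t => ∫ x in Set.Icc (0:ℝ) 1, F x t * d x) volume := by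
    simp_rw [eg]
    exact (LB _ h1).sub (LB _ h2)
  have mg : Measurable (fun t => ∫ x in Set.Icc (0:ℝ) 1, F x t * d x) := by
    simp_rw [eg]
    exact (slice_meas (B _ h1).1).sub (slice_meas (B _ h2).1)
  have bg : ∀ t, |∫ x in Set.Icc (0:ℝ) 1, F x t * d x| ≤ |mu| + |mu| := fun t => by
    rw [eg]
    exact (abs_sub _ _).trans (add_le_add (slice_bdd (B _ h1).2 t) (slice_bdd (B _ h2).2 t))
  refine energy (κ := κ) hlam Lf mg bg (weak_ode hT Lf ?_ ?_)
  · exact (Lf.smul (-(lam * κ ^ 2))).add (Lg.smul κ)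
  · intro φ hφ hφT
    have w1 := weak_mode hT h1 he hper hed hde he1 hd1 hφ hφT
    have w2 := weak_mode hT h2 he hper hed hde he1 hd1 hφ hφT
    have ii : ∀ ρ, IsWeakSolutionBurgers lam mu T ρ₀ ρ → IntervalIntegrable
        (fun t => deriv φ t * (∫ x in Set.Icc (0:ℝ) 1, trunc T ρ x t * e x)
          + φ t * (-(lam * κ ^ 2) * (∫ x in Set.Icc (0:ℝ) 1, trunc T ρ x t * e x)
          + κ * (∫ x in Set.Icc (0:ℝ) 1, (-mu * (trunc T ρ x t * (1 - trunc T ρ x t))) * d x)))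
        volume 0 T := fun ρ h =>
      ((locInt_ii (LA ρ h) 0 T).continuousOn_mul
        (hφ.continuous_deriv (by simp)).continuousOn).add
      ((((locInt_ii (LA ρ h) 0 T).const_mul _).add
        ((locInt_ii (LB ρ h) 0 T).const_mul _)).continuousOn_mul hφ.continuous.continuousOn)
    have := intervalIntegral.integral_sub (ii _ h1) (ii _ h2)
    have z : ∀ a b c : ℝ, a + c = 0 → b + c = 0 → a - b = 0 := fun a b c _ _ => by linarith
    rw [z _ _ _ w1 w2] at this
    refine Eq.trans ?_ this
    congr 1
    ext t
    rw [ef, eg]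
    ring

theorem stmt_13 (lam mu T : ℝ) (hlam : 0 < lam) (hT : 0 < T)
    (ρ₀ : ℝ → ℝ) (hmeas : Measurable ρ₀) (hper : ∀ x, ρ₀ (x + 1) = ρ₀ x)
    (hrange : ∀ x, ρ₀ x ∈ Set.Icc (0 : ℝ) 1)
    (ρ₁ ρ₂ : ℝ → ℝ → ℝ)
    (h1 : IsWeakSolutionBurgers lam mu T ρ₀ ρ₁)
    (h2 : IsWeakSolutionBurgers lam mu T ρ₀ ρ₂) :
    ∀ᵐ p ∂(volume.restrict (Set.Icc (0 : ℝ) 1 ×ˢ Set.Icc (0 : ℝ) T)),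
      ρ₁ p.1 p.2 = ρ₂ p.1 p.2 := by
  obtain ⟨w, hw⟩ : ∃ w : ℝ → ℝ → ℝ, w = fun x t => trunc T ρ₁ x t - trunc T ρ₂ x t := ⟨_, rfl⟩
  obtain ⟨F, hF⟩ : ∃ F : ℝ → ℝ → ℝ, F = fun x t => -mu * (trunc T ρ₁ x t * (1 - trunc T ρ₁ x t))
      - (-mu * (trunc T ρ₂ x t * (1 - trunc T ρ₂ x t))) := ⟨_, rfl⟩
  have m1 := trunc_meas h1
  have m2 := trunc_meas h2
  have b1 := trunc_mem h1
  have b2 := trunc_mem h2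
  have mw : Measurable (fun p : ℝ × ℝ => w p.1 p.2) := by
    rw [hw]; exact m1.sub m2
  have mF : Measurable (fun p : ℝ × ℝ => F p.1 p.2) := by
    rw [hF]
    exact ((m1.mul (m1.const_sub 1)).const_mul (-mu)).sub
      ((m2.mul (m2.const_sub 1)).const_mul (-mu))
  have bw : ∀ x t, |w x t| ≤ 1 := fun x t => by
    rw [hw, abs_le]
    have := b1 x t
    have := b2 x t
    constructor <;> simp only <;> linarith
  have hFw2 : ∀ x t, F x t ^ 2 ≤ mu ^ 2 * w x t ^ 2 := fun x t => by
    have e : F x t = -mu * w x t * (1 - trunc T ρ₁ x t - trunc T ρ₂ x t) := by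
      rw [hF, hw]; ring
    have hq : (1 - trunc T ρ₁ x t - trunc T ρ₂ x t) ^ 2 ≤ 1 := by
      rw [sq_le_one_iff_abs_le_one, abs_le]
      have := b1 x t
      have := b2 x t
      constructor <;> linarith
    rw [e, mul_pow, mul_pow, neg_sq]
    exact mul_le_of_le_one_right (by positivity) hq
  have bw2 : ∀ x t, |w x t ^ 2| ≤ 1 := fun x t => by
    rw [abs_pow]; exact pow_le_one₀ (abs_nonneg _) (bw x t)
  have bF : ∀ x t, |F x t| ≤ |mu| := fun x t => by
    rw [← sq_le_sq]
    refine (hFw2 x t).trans (mul_le_of_le_one_right (sq_nonneg _) ?_)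
    exact (le_abs_self _).trans (bw2 x t)
  have bF2 : ∀ x t, |F x t ^ 2| ≤ |mu| ^ 2 := fun x t => by
    rw [abs_pow]; exact pow_le_pow_left₀ (abs_nonneg _) (bF x t) 2
  have mw2 : Measurable (fun p : ℝ × ℝ => w p.1 p.2 ^ 2) := mw.pow_const 2
  have mF2 : Measurable (fun p : ℝ × ℝ => F p.1 p.2 ^ 2) := mF.pow_const 2
  have perc : ∀ k : ℤ, ∀ x : ℝ, 2 * Real.pi * k * (x + 1) = 2 * Real.pi * k * x + k * (2 * Real.pi) :=
    fun k x => by ring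
  have hlin : ∀ k : ℤ, ∀ x : ℝ,
      HasDerivAt (fun x : ℝ => 2 * Real.pi * k * x) (2 * Real.pi * k) x := fun k x => by
    simpa using (hasDerivAt_id x).const_mul (2 * Real.pi * (k : ℝ))
  have estc : ∀ k : ℤ, ∀ᵐ t ∂(volume.restrict (Set.Icc 0 T)),
      (∫ x in Set.Icc (0:ℝ) 1, w x t * Real.cos (2 * Real.pi * k * x)) ^ 2
        ≤ (1 / (2 * lam)) * ∫ s in (0:ℝ)..t,
          (∫ x in Set.Icc (0:ℝ) 1, F x s * Real.sin (2 * Real.pi * k * x)) ^ 2 := fun k => by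
    have := mode_est (κ := 2 * Real.pi * k) hlam hT h1 h2 hw hF
      (e := fun x => Real.cos (2 * Real.pi * k * x)) (d := fun x => -Real.sin (2 * Real.pi * k * x))
      (Real.contDiff_cos.comp (contDiff_const.mul contDiff_id))
      (fun x => by rw [perc, Real.cos_add_int_mul_two_pi])
      (fun x => by exact (hlin k x).cos.congr_deriv (by ring))
      (fun x => by exact (hlin k x).sin.neg.congr_deriv (by ring))
      (fun x => Real.abs_cos_le_one _) (fun x => by rw [abs_neg]; exact Real.abs_sin_le_one _)
    simpa only [mul_neg, integral_neg, neg_sq] using this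
  have ests : ∀ k : ℤ, ∀ᵐ t ∂(volume.restrict (Set.Icc 0 T)),
      (∫ x in Set.Icc (0:ℝ) 1, w x t * Real.sin (2 * Real.pi * k * x)) ^ 2
        ≤ (1 / (2 * lam)) * ∫ s in (0:ℝ)..t,
          (∫ x in Set.Icc (0:ℝ) 1, F x s * Real.cos (2 * Real.pi * k * x)) ^ 2 := fun k =>
    mode_est (κ := 2 * Real.pi * k) hlam hT h1 h2 hw hF
      (e := fun x => Real.sin (2 * Real.pi * k * x)) (d := fun x => Real.cos (2 * Real.pi * k * x))
      (Real.contDiff_sin.comp (contDiff_const.mul contDiff_id))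
      (fun x => by rw [perc, Real.sin_add_int_mul_two_pi])
      (fun x => by exact (hlin k x).sin.congr_deriv (by ring))
      (fun x => by exact (hlin k x).cos.congr_deriv (by ring))
      (fun x => Real.abs_sin_le_one _) (fun x => Real.abs_cos_le_one _)
  -- local integrability of the Fourier coefficients of F
  have LF : ∀ v : ℝ → ℝ, Measurable v → (∀ x, |v x| ≤ 1) → LocallyIntegrable
      (fun s => (∫ x in Set.Icc (0:ℝ) 1, F x s * v x) ^ 2) volume := fun v hv hv1 => by
    have bb : ∀ x t, |F x t * v x| ≤ |mu| := fun x t => by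
      rw [abs_mul]
      exact (mul_le_of_le_one_right (abs_nonneg _) (hv1 x)).trans (bF x t)
    refine bm_locInt (C := |mu| ^ 2) ((slice_meas (v := fun x t => F x t * v x)
      (mF.mul (hv.comp measurable_fst))).pow_const 2) fun s => ?_
    rw [abs_pow]
    exact pow_le_pow_left₀ (abs_nonneg _) (slice_bdd (v := fun x t => F x t * v x) bb s) 2
  have Lw2 : LocallyIntegrable (fun s => ∫ x in Set.Icc (0:ℝ) 1, w x s ^ 2) volume :=
    bm_locInt (slice_meas (v := fun x t => w x t ^ 2) mw2)
      (slice_bdd (v := fun x t => w x t ^ 2) bw2)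
  have main : ∀ᵐ t ∂(volume.restrict (Set.Icc 0 T)),
      (∫ x in Set.Icc (0:ℝ) 1, w x t ^ 2)
        ≤ ((1 / (2 * lam)) * mu ^ 2) * ∫ s in (0:ℝ)..t, ∫ x in Set.Icc (0:ℝ) 1, w x s ^ 2 := by
    filter_upwards [ae_all_iff.2 estc, ae_all_iff.2 ests, ae_restrict_mem measurableSet_Icc]
      with t hc hs htm
    refine hasSum_le_of_sum_le (parseval (slice_meas_x mw t) (fun x => bw x t)) fun S => ?_
    have iC : ∀ k : ℤ, IntervalIntegrable (fun s =>
        (∫ x in Set.Icc (0:ℝ) 1, F x s * Real.cos (2 * Real.pi * k * x)) ^ 2) volume 0 t :=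
      fun k => locInt_ii (LF (fun x => Real.cos (2 * Real.pi * k * x))
        (by fun_prop) (fun x => Real.abs_cos_le_one _)) 0 t
    have iS : ∀ k : ℤ, IntervalIntegrable (fun s =>
        (∫ x in Set.Icc (0:ℝ) 1, F x s * Real.sin (2 * Real.pi * k * x)) ^ 2) volume 0 t :=
      fun k => locInt_ii (LF (fun x => Real.sin (2 * Real.pi * k * x))
        (by fun_prop) (fun x => Real.abs_sin_le_one _)) 0 t
    calc _ ≤ ∑ k ∈ S, (1 / (2 * lam)) * ∫ s in (0:ℝ)..t,
          ((∫ x in Set.Icc (0:ℝ) 1, F x s * Real.cos (2 * Real.pi * k * x)) ^ 2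
          + (∫ x in Set.Icc (0:ℝ) 1, F x s * Real.sin (2 * Real.pi * k * x)) ^ 2) := by
          refine Finset.sum_le_sum fun k _ => ?_
          rw [intervalIntegral.integral_add (iC k) (iS k), mul_add]
          linarith [hc k, hs k]
      _ = (1 / (2 * lam)) * ∫ s in (0:ℝ)..t, ∑ k ∈ S,
          ((∫ x in Set.Icc (0:ℝ) 1, F x s * Real.cos (2 * Real.pi * k * x)) ^ 2
          + (∫ x in Set.Icc (0:ℝ) 1, F x s * Real.sin (2 * Real.pi * k * x)) ^ 2) := by
          rw [intervalIntegral.integral_finsetSum fun k _ => (iC k).add (iS k), Finset.mul_sum]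
      _ ≤ (1 / (2 * lam)) * ∫ s in (0:ℝ)..t, mu ^ 2 * ∫ x in Set.Icc (0:ℝ) 1, w x s ^ 2 := by
          refine mul_le_mul_of_nonneg_left ?_ (by positivity)
          refine intervalIntegral.integral_mono htm.1
            (by simpa only [Finset.sum_fn] using IntervalIntegrable.sum S fun k _ => (iC k).add (iS k))
            ((locInt_ii Lw2 0 t).const_mul _) fun s => ?_
          refine (sum_le_hasSum S (fun k _ => by positivity)
            (parseval (slice_meas_x mF s) (fun x => bF x s))).trans ?_
          rw [← integral_const_mul]
          exact integral_mono (slice_int (v := fun x t => F x t ^ 2) mF2 bF2 s)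
            ((slice_int (v := fun x t => w x t ^ 2) mw2 bw2 s).const_mul _) fun x => hFw2 x s
      _ = _ := by rw [intervalIntegral.integral_const_mul]; ring
  have hz := gronwall (K := (1 / (2 * lam)) * mu ^ 2) (M := 1) (by positivity) Lw2
    (fun t => (le_abs_self _).trans (slice_bdd (v := fun x t => w x t ^ 2) bw2 t)) main
  have hint : Integrable (fun p : ℝ × ℝ => w p.1 p.2 ^ 2)
      ((volume.restrict (Set.Icc (0:ℝ) 1)).prod (volume.restrict (Set.Icc (0:ℝ) T))) :=
    Integrable.of_bound mw2.aestronglyMeasurable 1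
      (Filter.Eventually.of_forall fun p => bw2 p.1 p.2)
  have hi0 : ∫ p, w p.1 p.2 ^ 2
      ∂((volume.restrict (Set.Icc (0:ℝ) 1)).prod (volume.restrict (Set.Icc (0:ℝ) T))) = 0 := by
    rw [integral_prod_symm _ hint]
    refine integral_eq_zero_of_ae ?_
    filter_upwards [hz] with t ht
    exact le_antisymm ht (integral_nonneg fun x => sq_nonneg _)
  rw [integral_eq_zero_iff_of_nonneg (fun p => sq_nonneg _) hint, Measure.prod_restrict] at hi0
  rw [Measure.volume_eq_prod]
  filter_upwards [hi0, ae_restrict_mem (measurableSet_Icc.prod measurableSet_Icc)] with p hp hpm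
  have hp' : w p.1 p.2 = 0 := by simpa using hp
  rw [hw] at hp'
  simp only [trunc, Set.indicator_of_mem hpm.2] at hp'
  linarith
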